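/- arXiv:1808.06898 — 4 statements merged into one kernel-verified Lean document; each statement's English description precedes it below -/
import Mathlib

section
/- Let H be an infinite-dimensional separable complex Hilbert space, let T be a compact operator on H with singular values s_1(T) ≥ s_2(T) ≥ … , and let (e_k)_{k∈ℕ} be an orthonormal system in H. Then for every n ∈ ℕ one has ∑_{k=1}^n |⟨e_k, T e_k⟩| ≤ ∑_{k=1}^n s_k(T). -/
open Filter
open scoped InnerProductSpace ENNReal

/-- The rank-one operator `x ↦ ⟪f, x⟫ • g`. -/
noncomputable def rankOne {H : Type*} [NormedAddCommGroup H] [InnerProductSpace ℂ H]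
    (f g : H) : H →L[ℂ] H :=
  (innerSL ℂ f).smulRight g

/-- A Schmidt decomposition of the compact operator `T`: a decreasing null sequence
`s` of nonnegative reals and orthonormal systems `f`, `g` with
`T = ∑ s n • ⟪f n, ·⟫ g n`, the series converging in operator norm. -/
structure IsSchmidtDecomp {H : Type*} [NormedAddCommGroup H] [InnerProductSpace ℂ H]
    (T : H →L[ℂ] H) (s : ℕ → ℝ) (f g : ℕ → H) : Prop where
  nonneg : ∀ n, 0 ≤ s n
  antitone : Antitone s
  tendsto_zero : Tendsto s atTop (nhds 0)
  orth_f : Orthonormal ℂ f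
  orth_g : Orthonormal ℂ g
  hasSum : Tendsto (fun N => ∑ n ∈ Finset.range N, s n • rankOne (f n) (g n)) atTop (nhds T)

theorem aux_bessel {H : Type*} [NormedAddCommGroup H] [InnerProductSpace ℂ H]
    (u : ℕ → H) (hu : Orthonormal ℂ u) (x : H) (hx : ‖x‖ = 1) (N : ℕ) :
    ∑ k ∈ Finset.range N, ‖⟪u k, x⟫_ℂ‖ ^ 2 ≤ 1 := by
  have h := hu.sum_inner_products_le x (s := Finset.range N)
  rw [hx] at h
  simpa using h

theorem aux_weights (s a : ℕ → ℝ) (hs0 : ∀ m, 0 ≤ s m) (hs : Antitone s)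
    (n N : ℕ) (hN : n ≤ N) (ha0 : ∀ m, 0 ≤ a m) (ha1 : ∀ m, a m ≤ 1)
    (ha : ∑ m ∈ Finset.range N, a m ≤ n) :
    ∑ m ∈ Finset.range N, s m * a m ≤ ∑ m ∈ Finset.range n, s m := by
  obtain ⟨j, rfl⟩ := Nat.exists_eq_add_of_le hN
  have h1 : ∑ m ∈ Finset.range (n + j), (s m - s n) * a m
      ≤ ∑ m ∈ Finset.range n, (s m - s n) := by
    rw [Finset.sum_range_add]
    have A : ∑ m ∈ Finset.range n, (s m - s n) * a m ≤ ∑ m ∈ Finset.range n, (s m - s n) := by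
      apply Finset.sum_le_sum
      intro m hm
      have := hs (Finset.mem_range.mp hm).le
      exact mul_le_of_le_one_right (by linarith) (ha1 m)
    have B : ∑ m ∈ Finset.range j, (s (n + m) - s n) * a (n + m) ≤ 0 := by
      apply Finset.sum_nonpos
      intro m _
      have := hs (Nat.le_add_right n m)
      exact mul_nonpos_of_nonpos_of_nonneg (by linarith) (ha0 _)
    linarith
  have h2 := mul_le_mul_of_nonneg_left ha (hs0 n)
  simp only [sub_mul, Finset.sum_sub_distrib, ← Finset.mul_sum, Finset.sum_const,
    Finset.card_range, nsmul_eq_mul] at h1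
  linarith

/-- If `T` is a compact operator on an infinite-dimensional separable complex
Hilbert space with singular values `s` (coming from a Schmidt decomposition) and `(e k)` is an
orthonormal system, then `∑_{k=1}^n |⟪e k, T (e k)⟫| ≤ ∑_{k=1}^n s k` for every `n`. -/
theorem stmt_0 {H : Type*} [NormedAddCommGroup H] [InnerProductSpace ℂ H] [CompleteSpace H]
    (b : HilbertBasis ℕ ℂ H)  -- `H` is infinite-dimensional and separable
    (T : H →L[ℂ] H) (hT : IsCompactOperator T)
    (s : ℕ → ℝ) (f g : ℕ → H) (hs : IsSchmidtDecomp T s f g)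
    (e : ℕ → H) (he : Orthonormal ℂ e) (n : ℕ) :
    ∑ k ∈ Finset.range n, ‖⟪e k, T (e k)⟫_ℂ‖ ≤ ∑ k ∈ Finset.range n, s k := by
  have key : ∀ N, n ≤ N → ∑ k ∈ Finset.range n,
      ‖⟪e k, (∑ m ∈ Finset.range N, s m • rankOne (f m) (g m)) (e k)⟫_ℂ‖
      ≤ ∑ k ∈ Finset.range n, s k := by
    intro N hN
    have comm : ∀ x y : H, ‖⟪x, y⟫_ℂ‖ = ‖⟪y, x⟫_ℂ‖ := fun x y => norm_inner_symm x y
    have amgm : ∀ x y : ℝ, x * y ≤ (x ^ 2 + y ^ 2) / 2 := by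
      intro x y
      nlinarith [sq_nonneg (x - y)]
    set a : ℕ → ℝ := fun m => ∑ k ∈ Finset.range n, ‖⟪f m, e k⟫_ℂ‖ * ‖⟪g m, e k⟫_ℂ‖ with ha
    have h1 : ∀ k, ‖⟪e k, (∑ m ∈ Finset.range N, s m • rankOne (f m) (g m)) (e k)⟫_ℂ‖
        ≤ ∑ m ∈ Finset.range N, s m * (‖⟪f m, e k⟫_ℂ‖ * ‖⟪g m, e k⟫_ℂ‖) := by
      intro k
      rw [ContinuousLinearMap.sum_apply, inner_sum]
      refine (norm_sum_le _ _).trans (Finset.sum_le_sum fun m _ => le_of_eq ?_)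
      have : (s m • rankOne (f m) (g m)) (e k) = ((s m : ℂ) * ⟪f m, e k⟫_ℂ) • g m := by
        simp [rankOne, mul_smul]
      rw [this, inner_smul_right, norm_mul, norm_mul, comm (e k) (g m), Complex.norm_real,
        Real.norm_of_nonneg (hs.nonneg m), mul_assoc]
    calc _ ≤ ∑ k ∈ Finset.range n, ∑ m ∈ Finset.range N,
          s m * (‖⟪f m, e k⟫_ℂ‖ * ‖⟪g m, e k⟫_ℂ‖) := Finset.sum_le_sum fun k _ => h1 k
      _ = ∑ m ∈ Finset.range N, s m * a m := by
          rw [Finset.sum_comm]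
          simp only [ha, Finset.mul_sum]
      _ ≤ _ := by
          refine aux_weights s a hs.nonneg hs.antitone n N hN
            (fun m => Finset.sum_nonneg fun k _ => by positivity) (fun m => ?_) ?_
          · have b1 := aux_bessel e he (f m) (hs.orth_f.1 m) n
            have b2 := aux_bessel e he (g m) (hs.orth_g.1 m) n
            refine (Finset.sum_le_sum fun k _ => amgm _ _).trans ?_
            rw [← Finset.sum_div, Finset.sum_add_distrib]
            simp only [comm (f m), comm (g m)]
            linarith
          · rw [Finset.sum_comm]
            calc _ ≤ ∑ k ∈ Finset.range n, (1 : ℝ) := by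
                  refine Finset.sum_le_sum fun k _ => ?_
                  have b1 := aux_bessel f hs.orth_f (e k) (he.1 k) N
                  have b2 := aux_bessel g hs.orth_g (e k) (he.1 k) N
                  refine (Finset.sum_le_sum fun m _ => amgm _ _).trans ?_
                  rw [← Finset.sum_div, Finset.sum_add_distrib]
                  linarith
              _ = n := by simp
  have lim : Tendsto (fun N => ∑ k ∈ Finset.range n,
      ‖⟪e k, (∑ m ∈ Finset.range N, s m • rankOne (f m) (g m)) (e k)⟫_ℂ‖) atTop
      (nhds (∑ k ∈ Finset.range n, ‖⟪e k, T (e k)⟫_ℂ‖)) := by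
    have hc : Continuous fun S : H →L[ℂ] H => ∑ k ∈ Finset.range n, ‖⟪e k, S (e k)⟫_ℂ‖ := by
      fun_prop
    exact (hc.tendsto T).comp hs.hasSum
  exact le_of_tendsto lim (eventually_atTop.mpr ⟨n, key⟩)
end

section
/- Let (A_n)_{n∈ℕ} be a bounded sequence of non-empty compact subsets of ℂ converging in the Hausdorff metric to A, and let (z_n)_{n∈ℕ} be a sequence of complex numbers converging to z. If A_n is star-shaped with respect to z_n for all n ∈ ℕ, then A is star-shaped with respect to z. -/
open Filter Metric

/-- If `(A n)` is a bounded sequence of non-empty compact subsets of `ℂ`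
converging in the Hausdorff metric to `A`, with `A n` star-shaped with respect to `z n` and
`z n → z`, then `A` is star-shaped with respect to `z`. -/
theorem stmt_5 (A : Set ℂ) (An : ℕ → Set ℂ) (z : ℂ) (zn : ℕ → ℂ)
    (hAne : ∀ n, (An n).Nonempty) (hAc : ∀ n, IsCompact (An n))
    (hbdd : ∃ M : ℝ, ∀ n, An n ⊆ closedBall 0 M)
    (hAne' : A.Nonempty) (hAc' : IsCompact A)
    (hA : Tendsto (fun n => hausdorffDist (An n) A) atTop (nhds 0))
    (hz : Tendsto zn atTop (nhds z))
    (hstar : ∀ n, zn n ∈ An n ∧ StarConvex ℝ (zn n) (An n)) :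
    z ∈ A ∧ StarConvex ℝ z A := by
  have hfin : ∀ n, hausdorffEDist (An n) A ≠ ⊤ := fun n =>
    hausdorffEDist_ne_top_of_nonempty_of_bounded (hAne n) hAne' (hAc n).isBounded hAc'.isBounded
  have key : ∀ (x : ℂ) (xn : ℕ → ℂ), (∀ n, xn n ∈ An n) → Tendsto xn atTop (nhds x) → x ∈ A := by
    intro x xn hx hlim
    have h1 : Tendsto (fun n => infDist (xn n) A) atTop (nhds (infDist x A)) :=
      ((continuous_infDist_pt A).tendsto x).comp hlim
    have h2 : infDist x A ≤ 0 := le_of_tendsto_of_tendsto' h1 hA fun n =>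
      infDist_le_hausdorffDist_of_mem (hx n) (hfin n)
    exact (hAc'.isClosed.mem_iff_infDist_zero hAne').2 (le_antisymm h2 infDist_nonneg)
  refine ⟨key z zn (fun n => (hstar n).1) hz, ?_⟩
  intro w hw a b ha hb hab
  choose wn hwn hd using fun n => (hAc n).exists_infDist_eq_dist (hAne n) w
  have hwlim : Tendsto wn atTop (nhds w) := by
    rw [tendsto_iff_dist_tendsto_zero]
    refine squeeze_zero (fun _ => dist_nonneg) (fun n => ?_) hA
    rw [dist_comm, ← hd n, hausdorffDist_comm]
    exact infDist_le_hausdorffDist_of_mem hw (by rw [hausdorffEDist_comm]; exact hfin n)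
  exact key _ (fun n => a • zn n + b • wn n)
    (fun n => (hstar n).2 (hwn n) ha hb hab) ((hz.const_smul a).add (hwlim.const_smul b))
end

section
/- Let H be an infinite-dimensional separable complex Hilbert space, let p, q ∈ [1,∞] with 1/p + 1/q = 1, let C ∈ B^p(H) and T ∈ B^q(H), and let (S_n)_{n∈ℕ} be a sequence of bounded operators on H converging strongly to a bounded operator S. Then lim_{n→∞} tr(C S_n† T S_n) = tr(C S† T S). -/
open Filter
open scoped InnerProductSpace ENNReal

/-- The `n`-th singular value (`0`-indexed) of an operator, defined as its distance (in
operator norm) to the operators of rank at most `n`; for compact operators this coincides with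
the `(n+1)`-st coefficient of a Schmidt decomposition. -/
noncomputable def sv {H : Type*} [NormedAddCommGroup H] [InnerProductSpace ℂ H]
    (T : H →L[ℂ] H) (n : ℕ) : ℝ :=
  ⨅ (u : Fin n → H) (v : Fin n → H), ‖T - ∑ i, rankOne (u i) (v i)‖

/-- Membership in the `p`-th Schatten class `B^p(H)`, `p ∈ [1,∞]`:  compact and, if `p ≠ ∞`,
`p`-summable singular values. -/
def MemSchatten {H : Type*} [NormedAddCommGroup H] [InnerProductSpace ℂ H]
    (p : ℝ≥0∞) (T : H →L[ℂ] H) : Prop :=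
  IsCompactOperator T ∧ (p ≠ ∞ → Summable fun n => sv T n ^ p.toReal)

/-- The Schatten `p`-norm `ν_p`. -/
noncomputable def schattenNorm {H : Type*} [NormedAddCommGroup H] [InnerProductSpace ℂ H]
    (p : ℝ≥0∞) (T : H →L[ℂ] H) : ℝ :=
  if p = ∞ then ‖T‖ else (∑' n, sv T n ^ p.toReal) ^ (1 / p.toReal)

/-- The trace of an operator computed along the orthonormal basis `b`; for trace-class
operators this is basis-independent. -/
noncomputable def traceAlong {H : Type*} [NormedAddCommGroup H] [InnerProductSpace ℂ H]
    [CompleteSpace H] (b : HilbertBasis ℕ ℂ H) (A : H →L[ℂ] H) : ℂ :=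
  ∑' i, ⟪(b i : H), A (b i)⟫_ℂ

section aux
variable {H : Type*} [NormedAddCommGroup H] [InnerProductSpace ℂ H]

def Rk (r : ℕ) (A : H →L[ℂ] H) : Prop := LinearMap.rank (A : H →ₗ[ℂ] H) ≤ (r : Cardinal)

theorem Rk.sub {r s : ℕ} {A B : H →L[ℂ] H} (hA : Rk r A) (hB : Rk s B) : Rk (r + s) (A - B) := by
  unfold Rk at *
  have h1 : ((A - B : H →L[ℂ] H) : H →ₗ[ℂ] H) = (A : H →ₗ[ℂ] H) + (-(B : H →ₗ[ℂ] H)) := by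
    ext x; simp [sub_eq_add_neg]
  rw [h1]
  refine (LinearMap.rank_add_le _ _).trans ?_
  push_cast
  refine add_le_add hA ?_
  have : LinearMap.rank (-(B : H →ₗ[ℂ] H)) = LinearMap.rank (B : H →ₗ[ℂ] H) := by
    unfold LinearMap.rank; rw [LinearMap.range_neg]
  rw [this]; exact hB

theorem Rk.mono {r s : ℕ} {A : H →L[ℂ] H} (hA : Rk r A) (h : r ≤ s) : Rk s A :=
  le_trans (b := (r : Cardinal)) hA (by exact_mod_cast h)

theorem Rk.zero : Rk 0 (0 : H →L[ℂ] H) := by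
  unfold Rk; simp

theorem Rk.sum {n : ℕ} (u v : Fin n → H) : Rk n (∑ i, rankOne (u i) (v i)) := by
  unfold Rk
  have : ((∑ i, rankOne (u i) (v i) : H →L[ℂ] H) : H →ₗ[ℂ] H)
      = ∑ i, (rankOne (u i) (v i) : H →ₗ[ℂ] H) := by
    ext x; simp
  rw [this]
  refine (LinearMap.rank_finsetSum_le _ _).trans ?_
  calc _ ≤ ∑ i : Fin n, (1 : Cardinal) := by
        refine Finset.sum_le_sum fun i _ => ?_
        have hr : LinearMap.range (rankOne (u i) (v i) : H →ₗ[ℂ] H) ≤ Submodule.span ℂ {v i} := by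
          rintro _ ⟨x, rfl⟩
          simp only [rankOne, ContinuousLinearMap.coe_coe, ContinuousLinearMap.smulRight_apply]
          exact Submodule.smul_mem _ _ (Submodule.mem_span_singleton_self _)
        refine (Submodule.rank_mono hr).trans ?_
        refine (rank_span_le _).trans ?_
        simp
    _ = _ := by simp

theorem Rk.exists {r : ℕ} {A : H →L[ℂ] H} (hA : Rk r A) :
    ∃ m ≤ r, ∃ w : Fin m → H, Orthonormal ℂ w ∧ ∀ x, A x = ∑ j, ⟪w j, A x⟫_ℂ • w j := by
  have hlt : Module.rank ℂ (LinearMap.range (A : H →ₗ[ℂ] H)) < Cardinal.aleph0 :=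
    lt_of_le_of_lt hA (Cardinal.natCast_lt_aleph0)
  have : Module.Finite ℂ (LinearMap.range (A : H →ₗ[ℂ] H)) := Module.rank_lt_aleph0_iff.1 hlt
  let V := LinearMap.range (A : H →ₗ[ℂ] H)
  refine ⟨Module.finrank ℂ V, ?_, fun j => (stdOrthonormalBasis ℂ V j : H), ?_, ?_⟩
  · have : (Module.finrank ℂ V : Cardinal) ≤ r := by rw [Module.finrank_eq_rank]; exact hA
    exact_mod_cast this
  · exact (stdOrthonormalBasis ℂ V).orthonormal.comp_linearIsometry V.subtypeₗᵢ
  · intro x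
    have := (stdOrthonormalBasis ℂ V).sum_repr' ⟨A x, ⟨x, rfl⟩⟩
    have := congrArg (Subtype.val) this
    refine this.symm.trans ?_
    simp only [Submodule.coe_sum, Submodule.coe_smul, Submodule.coe_inner]

theorem exists_sv (A : H →L[ℂ] H) (n : ℕ) {ε : ℝ} (hε : 0 < ε) :
    ∃ F, Rk n F ∧ ‖A - F‖ < sv A n + ε := by
  have h : sv A n < sv A n + ε := by linarith
  obtain ⟨u, hu⟩ := exists_lt_of_ciInf_lt (show (⨅ (u : Fin n → H), ⨅ (v : Fin n → H),
    ‖A - ∑ i, rankOne (u i) (v i)‖) < _ from h)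
  obtain ⟨v, hv⟩ := exists_lt_of_ciInf_lt hu
  exact ⟨_, Rk.sum u v, hv⟩

theorem sv_nonneg (A : H →L[ℂ] H) (n : ℕ) : 0 ≤ sv A n :=
  Real.iInf_nonneg fun _ => Real.iInf_nonneg fun _ => norm_nonneg _

theorem sv_le (A : H →L[ℂ] H) (n : ℕ) (u v : Fin n → H) :
    sv A n ≤ ‖A - ∑ i, rankOne (u i) (v i)‖ := by
  unfold sv
  refine (ciInf_le ⟨0, ?_⟩ u).trans (ciInf_le ⟨0, ?_⟩ v)
  · rintro _ ⟨x, rfl⟩; exact Real.iInf_nonneg fun _ => norm_nonneg _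
  · rintro _ ⟨x, rfl⟩; exact norm_nonneg _

theorem sv_anti (A : H →L[ℂ] H) : Antitone (sv A) := by
  refine antitone_nat_of_succ_le fun n => ?_
  refine le_ciInf fun u => le_ciInf fun v => ?_
  refine (sv_le A (n + 1) (Fin.snoc u 0) (Fin.snoc v 0)).trans (le_of_eq ?_)
  rw [Fin.sum_univ_castSucc]
  simp [rankOne]

theorem exists_compact_approx [CompleteSpace H] (A : H →L[ℂ] H) (hA : IsCompactOperator A)
    {ε : ℝ} (hε : 0 < ε) : ∃ r F, Rk r F ∧ ‖A - F‖ ≤ ε := by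
  obtain ⟨K, hK, hKA⟩ := IsCompactOperator.image_subset_compact_of_bounded (f := (A : H →ₗ[ℂ] H)) hA
    (Metric.isBounded_closedBall (x := (0 : H)) (r := 1))
  obtain ⟨t, htf, htc⟩ := Metric.totallyBounded_iff.1 hK.totallyBounded ε hε
  let V := Submodule.span ℂ t
  have : FiniteDimensional ℂ V := FiniteDimensional.span_of_finite ℂ htf
  refine ⟨Module.finrank ℂ V, V.starProjection * A, ?_, ?_⟩
  · unfold Rk LinearMap.rank
    rw [Module.finrank_eq_rank]
    refine Submodule.rank_mono ?_
    rintro _ ⟨x, rfl⟩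
    exact Submodule.starProjection_apply_mem V (A x)
  · refine ContinuousLinearMap.opNorm_le_of_unit_norm (𝕜 := ℂ) hε.le fun x hx => ?_
    have hx' : A x ∈ K := hKA ⟨x, by simp [hx], rfl⟩
    obtain ⟨y, hy, hxy⟩ := Set.mem_iUnion₂.1 (htc hx')
    have h1 := V.starProjection_minimal (A x)
    have h2 : ‖A x - V.starProjection (A x)‖ ≤ ‖A x - y‖ := by
      rw [h1]
      exact ciInf_le (f := fun z : V => ‖A x - z‖) ⟨0, by rintro _ ⟨x, rfl⟩; exact norm_nonneg _⟩
        ⟨y, Submodule.subset_span hy⟩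
    rw [Metric.mem_ball, dist_eq_norm] at hxy
    simpa using h2.trans hxy.le

end aux

section aux2
variable {H : Type*} [NormedAddCommGroup H] [InnerProductSpace ℂ H] [CompleteSpace H]

theorem parseval_le (b : HilbertBasis ℕ ℂ H) (x y : H) (s : Finset ℕ) :
    ∑ i ∈ s, ‖⟪x, b i⟫_ℂ * ⟪b i, y⟫_ℂ‖ ≤ ‖x‖ * ‖y‖ := by
  simp_rw [norm_mul, norm_inner_symm x]
  refine (Real.sum_mul_le_sqrt_mul_sqrt _ _ _).trans ?_
  refine mul_le_mul ?_ ?_ (Real.sqrt_nonneg _) (norm_nonneg _)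
  · exact Real.sqrt_le_iff.2 ⟨norm_nonneg _, b.orthonormal.sum_inner_products_le x⟩
  · exact Real.sqrt_le_iff.2 ⟨norm_nonneg _, b.orthonormal.sum_inner_products_le y⟩

theorem trace_expand {m : ℕ} {w : Fin m → H} {A : H →L[ℂ] H}
    (hw : ∀ x, A x = ∑ j, ⟪w j, A x⟫_ℂ • w j) (X Y : H →L[ℂ] H) (z : H) :
    ⟪z, (X * A * Y) z⟫_ℂ = ∑ j, ⟪star (A * Y) (w j), z⟫_ℂ * ⟪z, X (w j)⟫_ℂ := by
  have : (X * A * Y) z = ∑ j, ⟪w j, A (Y z)⟫_ℂ • X (w j) := by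
    change X (A (Y z)) = _
    conv_lhs => rw [hw (Y z)]
    simp
  rw [this, inner_sum]
  refine Finset.sum_congr rfl fun j _ => ?_
  rw [inner_smul_right, ContinuousLinearMap.star_eq_adjoint,
    ContinuousLinearMap.adjoint_inner_left]
  rfl

theorem trace_sum_le (b : HilbertBasis ℕ ℂ H) {r : ℕ} {A : H →L[ℂ] H} (hA : Rk r A)
    (X Y : H →L[ℂ] H) (s : Finset ℕ) :
    ∑ i ∈ s, ‖⟪(b i : H), (X * A * Y) (b i)⟫_ℂ‖ ≤ r * (‖X‖ * ‖A‖ * ‖Y‖) := by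
  obtain ⟨m, hm, w, ho, hw⟩ := hA.exists
  calc _ ≤ ∑ i ∈ s, ∑ j, ‖⟪star (A * Y) (w j), b i⟫_ℂ * ⟪b i, X (w j)⟫_ℂ‖ := by
        refine Finset.sum_le_sum fun i _ => ?_
        rw [trace_expand hw]
        exact norm_sum_le _ _
    _ = ∑ j, ∑ i ∈ s, ‖⟪star (A * Y) (w j), b i⟫_ℂ * ⟪b i, X (w j)⟫_ℂ‖ := Finset.sum_comm
    _ ≤ ∑ j : Fin m, ‖X‖ * ‖A‖ * ‖Y‖ := by
        refine Finset.sum_le_sum fun j _ => ?_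
        refine (parseval_le b _ _ s).trans ?_
        have h1 : ‖star (A * Y) (w j)‖ ≤ ‖A‖ * ‖Y‖ := by
          refine (ContinuousLinearMap.le_opNorm _ _).trans ?_
          rw [ho.1 j, mul_one, norm_star]
          exact norm_mul_le _ _
        have h2 : ‖X (w j)‖ ≤ ‖X‖ := by
          refine (ContinuousLinearMap.le_opNorm _ _).trans ?_
          rw [ho.1 j, mul_one]
        calc _ ≤ (‖A‖ * ‖Y‖) * ‖X‖ := mul_le_mul h1 h2 (norm_nonneg _) (by positivity)
          _ = _ := by ring
    _ = m * (‖X‖ * ‖A‖ * ‖Y‖) := by simp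
    _ ≤ _ := by gcongr

theorem trace_tendsto (b : HilbertBasis ℕ ℂ H) {r : ℕ} {D : H →L[ℂ] H} (hD : Rk r D)
    (E S : H →L[ℂ] H) (Sn : ℕ → H →L[ℂ] H)
    (hstrong : ∀ x : H, Tendsto (fun n => Sn n x) atTop (nhds (S x))) :
    Tendsto (fun n => traceAlong b (D * star (Sn n) * E * Sn n)) atTop
      (nhds (traceAlong b (D * star S * E * S))) := by
  obtain ⟨m, hm, w, ho, hw⟩ := hD.exists
  have key : ∀ R : H →L[ℂ] H, traceAlong b (D * star R * E * R)
      = ∑ j, ⟪R (star D (w j)), E (R (w j))⟫_ℂ := by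
    intro R
    have h0 : D * star R * E * R = 1 * D * (star R * E * R) := by simp [mul_assoc]
    unfold traceAlong
    rw [h0]
    simp_rw [trace_expand hw]
    refine (hasSum_sum fun j _ => b.hasSum_inner_mul_inner _ _).tsum_eq.trans ?_
    refine Finset.sum_congr rfl fun j _ => ?_
    simp only [ContinuousLinearMap.star_eq_adjoint, ContinuousLinearMap.adjoint_inner_left]
    change ⟪w j, D ((ContinuousLinearMap.adjoint R) (E (R (w j))))⟫_ℂ = _
    rw [← ContinuousLinearMap.adjoint_inner_left D, ContinuousLinearMap.adjoint_inner_right R]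
  simp_rw [key]
  refine tendsto_finsetSum _ fun j _ => ?_
  exact (hstrong _).inner ((E.continuous.tendsto _).comp (hstrong _))

theorem main_abstract (b : HilbertBasis ℕ ℂ H) (C T : H →L[ℂ] H) (D E : ℕ → H →L[ℂ] H)
    (r s : ℕ → ℕ) (hr : ∀ k, Rk (r k) (D k)) (hs : ∀ l, Rk (s l) (E l))
    (hDn : Summable fun k => ‖D k‖) (hEn : Summable fun l => ‖E l‖)
    (hD : HasSum D C) (hE : HasSum E T)
    (hsum : Summable fun z : ℕ × ℕ => ((min (r z.1) (s z.2) : ℕ) : ℝ) * (‖D z.1‖ * ‖E z.2‖))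
    (S : H →L[ℂ] H) (Sn : ℕ → H →L[ℂ] H)
    (hstrong : ∀ x : H, Tendsto (fun n => Sn n x) atTop (nhds (S x))) :
    Tendsto (fun n => traceAlong b (C * star (Sn n) * T * Sn n)) atTop
      (nhds (traceAlong b (C * star S * T * S))) := by
  -- finite partial sums bound
  have hb : ∀ (R : H →L[ℂ] H) (z : ℕ × ℕ) (u : Finset ℕ),
      ∑ i ∈ u, ‖⟪(b i : H), (D z.1 * star R * E z.2 * R) (b i)⟫_ℂ‖ ≤
        ((min (r z.1) (s z.2) : ℕ) : ℝ) * (‖D z.1‖ * ‖E z.2‖) * ‖R‖ ^ 2 := by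
    intro R z u
    rcases le_total (r z.1) (s z.2) with h | h
    · rw [min_eq_left h]
      have h0 : D z.1 * star R * E z.2 * R = 1 * D z.1 * (star R * E z.2 * R) := by
        simp [mul_assoc]
      rw [h0]
      refine (trace_sum_le b (hr z.1) _ _ u).trans ?_
      have h1 : ‖star R * E z.2 * R‖ ≤ ‖R‖ * ‖E z.2‖ * ‖R‖ := by
        refine (norm_mul_le _ _).trans ?_
        gcongr
        refine (norm_mul_le _ _).trans ?_
        rw [norm_star]
      have h2 : ‖(1 : H →L[ℂ] H)‖ ≤ 1 := ContinuousLinearMap.norm_id_le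
      calc _ ≤ (r z.1 : ℝ) * (1 * ‖D z.1‖ * (‖R‖ * ‖E z.2‖ * ‖R‖)) := by gcongr
        _ = _ := by ring
    · rw [min_eq_right h]
      refine (trace_sum_le b (hs z.2) _ _ u).trans ?_
      have h1 : ‖D z.1 * star R‖ ≤ ‖D z.1‖ * ‖R‖ := by
        refine (norm_mul_le _ _).trans ?_
        rw [norm_star]
      calc _ ≤ (s z.2 : ℝ) * (‖D z.1‖ * ‖R‖ * ‖E z.2‖ * ‖R‖) := by gcongr
        _ = _ := by ring
  have hsi : ∀ (R : H →L[ℂ] H) (z : ℕ × ℕ), Summable fun i =>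
      ‖⟪(b i : H), (D z.1 * star R * E z.2 * R) (b i)⟫_ℂ‖ := fun R z =>
    summable_of_sum_le (fun _ => norm_nonneg _) (hb R z)
  have hti : ∀ (R : H →L[ℂ] H) (z : ℕ × ℕ), ∑' i,
      ‖⟪(b i : H), (D z.1 * star R * E z.2 * R) (b i)⟫_ℂ‖ ≤
      ((min (r z.1) (s z.2) : ℕ) : ℝ) * (‖D z.1‖ * ‖E z.2‖) * ‖R‖ ^ 2 := fun R z =>
    (hsi R z).tsum_le_of_sum_le (hb R z)
  have key : ∀ R : H →L[ℂ] H, traceAlong b (C * star R * T * R) =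
      ∑' z : ℕ × ℕ, traceAlong b (D z.1 * star R * E z.2 * R) := by
    intro R
    unfold traceAlong
    rw [← Summable.tsum_comm]
    · refine tsum_congr fun i => ?_
      have e1 : Summable fun l => ‖star R * E l * R‖ := by
        refine Summable.of_nonneg_of_le (fun _ => norm_nonneg _) (fun l => ?_)
          ((hEn.mul_left ‖star R‖).mul_right ‖R‖)
        refine (norm_mul_le _ _).trans ?_
        gcongr
        exact norm_mul_le _ _
      have e2 : HasSum (fun l => star R * E l * R) (star R * T * R) :=
        (hE.mul_left _).mul_right _
      have e3 : HasSum (fun z : ℕ × ℕ => D z.1 * (star R * E z.2 * R))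
          (C * (star R * T * R)) := by
        have := (summable_mul_of_summable_norm hDn e1).hasSum
        rwa [← tsum_mul_tsum_of_summable_norm hDn e1, hD.tsum_eq, e2.tsum_eq] at this
      have e4 := (e3.mapL (ContinuousLinearMap.apply ℂ H (b i : H))).mapL (innerSL ℂ (b i : H))
      refine Eq.trans ?_ (e4.tsum_eq.symm.trans ?_)
      · simp [mul_assoc]
      · refine tsum_congr fun z => ?_
        simp [mul_assoc]
    · refine Summable.of_norm ?_
      refine (summable_prod_of_nonneg (fun _ => norm_nonneg _)).2 ⟨fun z => hsi R z, ?_⟩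
      refine Summable.of_nonneg_of_le (fun z => tsum_nonneg fun _ => norm_nonneg _)
        (fun z => hti R z) (hsum.mul_right _)
  obtain ⟨M, hM⟩ : ∃ M, ∀ n, ‖Sn n‖ ≤ M := by
    refine banach_steinhaus fun x => ?_
    obtain ⟨M, hM⟩ := (hstrong x).norm.bddAbove_range
    exact ⟨M, fun i => hM ⟨i, rfl⟩⟩
  simp_rw [key]
  refine tendsto_tsum_of_dominated_convergence (hsum.mul_right (M ^ 2))
    (fun z => trace_tendsto b (hr z.1) (E z.2) S Sn hstrong) (Eventually.of_forall fun n z => ?_)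
  refine (norm_tsum_le_tsum_norm (hsi (Sn n) z)).trans ((hti (Sn n) z).trans ?_)
  gcongr
  exact hM n

end aux2

theorem add_rpow_le_aux {x y p : ℝ} (hx : 0 ≤ x) (hy : 0 ≤ y) (hp : 0 ≤ p) :
    (x + y) ^ p ≤ 2 ^ p * (x ^ p + y ^ p) := by
  have h1 := Real.rpow_nonneg hx p
  have h2 := Real.rpow_nonneg hy p
  rcases le_total x y with h | h
  · calc (x + y) ^ p ≤ (2 * y) ^ p := Real.rpow_le_rpow (by positivity) (by linarith) hp
      _ = 2 ^ p * y ^ p := Real.mul_rpow (by norm_num) hy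
      _ ≤ _ := by gcongr; linarith
  · calc (x + y) ^ p ≤ (2 * x) ^ p := Real.rpow_le_rpow (by positivity) (by linarith) hp
      _ = 2 ^ p * x ^ p := Real.mul_rpow (by norm_num) hx
      _ ≤ _ := by gcongr; linarith

theorem summable_of_dyadic {x : ℕ → ℝ} (hx : ∀ k, 0 ≤ x k) {p : ℝ} (hp : 1 ≤ p)
    (h : Summable fun k => (2 : ℝ) ^ k * x k ^ p) : Summable x := by
  have hp0 : 0 < p := by linarith
  have hg : Summable fun k : ℕ => (((1 / 2 : ℝ) ^ (1 / p)) ^ k) :=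
    summable_geometric_of_lt_one (by positivity)
      (Real.rpow_lt_one (by norm_num) (by norm_num) (by positivity))
  refine Summable.of_norm_bounded_eventually_nat hg ?_
  filter_upwards [h.tendsto_atTop_zero.eventually (ge_mem_nhds zero_lt_one)] with k hk
  rw [Real.norm_of_nonneg (hx k)]
  have h1 : x k ^ p ≤ (1 / 2 : ℝ) ^ k := by
    rw [one_div, inv_pow, ← one_div, le_div_iff₀ (by positivity)]
    linarith
  calc x k = (x k ^ p) ^ (1 / p) := by
        rw [← Real.rpow_mul (hx k), mul_one_div_cancel hp0.ne', Real.rpow_one]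
    _ ≤ ((1 / 2 : ℝ) ^ k) ^ (1 / p) :=
        Real.rpow_le_rpow (Real.rpow_nonneg (hx k) _) h1 (by positivity)
    _ = _ := by
        rw [← Real.rpow_natCast, ← Real.rpow_natCast, ← Real.rpow_mul (by norm_num),
          ← Real.rpow_mul (by norm_num), mul_comm]

theorem summable_shift {ρ : ℝ} (h0 : 0 ≤ ρ) (h1 : ρ < 1) {A : ℕ → ℝ} (hA : Summable A)
    (hA0 : ∀ k, 0 ≤ A k) :
    Summable fun z : ℕ × ℕ => A z.1 * ρ ^ ((z.2 : ℤ) - z.1).natAbs := by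
  have hz : Summable fun n : ℤ => ρ ^ n.natAbs := by
    refine summable_int_iff_summable_nat_and_neg.2 ⟨?_, ?_⟩ <;>
    simpa using summable_geometric_of_lt_one h0 h1
  have := hA.mul_of_nonneg hz hA0 (fun n => by positivity)
  have hinj : Function.Injective fun z : ℕ × ℕ => (z.1, (z.2 : ℤ) - z.1) := by
    rintro ⟨a, b⟩ ⟨c, d⟩ h
    simp only [Prod.mk.injEq] at h
    obtain ⟨h1, h2⟩ := h
    subst h1
    simp at h2
    simp [h2]
  exact this.comp_injective hinj

theorem summable_schur {p q : ℝ} (hpq : p.HolderConjugate q) {x y : ℕ → ℝ} (hx : ∀ k, 0 ≤ x k)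
    (hy : ∀ k, 0 ≤ y k) (hxs : Summable fun k => (2 : ℝ) ^ k * x k ^ p)
    (hys : Summable fun k => (2 : ℝ) ^ k * y k ^ q) :
    Summable fun z : ℕ × ℕ => (2 : ℝ) ^ (min z.1 z.2) * (x z.1 * y z.2) := by
  have hp := hpq.pos
  have hq := hpq.symm.pos
  have hinv : 1 / p + 1 / q = 1 := by
    have := hpq.inv_add_inv_eq_one
    simpa using this
  set θ := min (1 / p) (1 / q) with hθ
  have hθ0 : 0 < θ := lt_min (by positivity) (by positivity)
  set ρ : ℝ := 2 ^ (-θ) with hρ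
  have hρ0 : 0 ≤ ρ := by positivity
  have hρ1 : ρ < 1 := Real.rpow_lt_one_of_one_lt_of_neg (by norm_num) (by linarith)
  have s1 := summable_shift hρ0 hρ1 hxs (fun k => by have := Real.rpow_nonneg (hx k) p; positivity)
  have s2 := (summable_shift hρ0 hρ1 hys
    (fun k => by have := Real.rpow_nonneg (hy k) q; positivity)).prod_symm
  refine Summable.of_nonneg_of_le (fun z => ?_) (fun z => ?_) (s1.add s2)
  · have := hx z.1; have := hy z.2; positivity
  obtain ⟨k, l⟩ := z
  have hsym : ((k : ℤ) - l).natAbs = ((l : ℤ) - k).natAbs := by omega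
  simp only [Prod.swap, hsym]
  rw [← add_mul]
  have ha : ∀ (p : ℝ), 0 < p → ∀ (x : ℝ), 0 ≤ x → ∀ k : ℕ,
      ((2 : ℝ) ^ ((k : ℝ) / p) * x) ^ p = 2 ^ k * x ^ p := by
    intro p hp x hx k
    rw [Real.mul_rpow (by positivity) hx, ← Real.rpow_mul (by norm_num), div_mul_cancel₀ _ hp.ne',
      Real.rpow_natCast]
  have hY := Real.young_inequality_of_nonneg (a := (2 : ℝ) ^ ((k : ℝ) / p) * x k)
    (b := (2 : ℝ) ^ ((l : ℝ) / q) * y l) (mul_nonneg (by positivity) (hx k))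
    (mul_nonneg (by positivity) (hy l)) hpq
  rw [ha p hp _ (hx k), ha q hq _ (hy l)] at hY
  have hX0 : 0 ≤ (2 : ℝ) ^ k * x k ^ p := by have := Real.rpow_nonneg (hx k) p; positivity
  have hY0 : 0 ≤ (2 : ℝ) ^ l * y l ^ q := by have := Real.rpow_nonneg (hy l) q; positivity
  have hY' := hY.trans (add_le_add (div_le_self hX0 hpq.lt.le) (div_le_self hY0 hpq.symm.lt.le))
  have hexp : (2 : ℝ) ^ (min k l) ≤
      (2 : ℝ) ^ ((k : ℝ) / p) * 2 ^ ((l : ℝ) / q) * ρ ^ ((l : ℤ) - k).natAbs := by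
    rw [hρ, ← Real.rpow_natCast, ← Real.rpow_natCast, ← Real.rpow_mul (by norm_num),
      ← Real.rpow_add (by norm_num), ← Real.rpow_add (by norm_num)]
    refine Real.rpow_le_rpow_of_exponent_le (by norm_num) ?_
    have t1 : θ ≤ 1 / p := min_le_left _ _
    have t2 : θ ≤ 1 / q := min_le_right _ _
    rw [div_eq_mul_one_div, div_eq_mul_one_div (l : ℝ)]
    rcases le_total k l with h | h
    · obtain ⟨d, rfl⟩ := Nat.exists_eq_add_of_le h
      have : ((k + d : ℕ) : ℤ) - k = d := by push_cast; ring
      rw [this, min_eq_left h, Int.natAbs_natCast]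
      push_cast
      have hd : (0 : ℝ) ≤ d := Nat.cast_nonneg _
      have hk' : (k : ℝ) * (1 / p) + k * (1 / q) = k := by rw [← mul_add, hinv, mul_one]
      nlinarith
    · obtain ⟨d, rfl⟩ := Nat.exists_eq_add_of_le h
      have : ((l : ℤ) - ((l + d : ℕ) : ℤ)) = -d := by push_cast; ring
      rw [this, min_eq_right h, Int.natAbs_neg, Int.natAbs_natCast]
      push_cast
      have hd : (0 : ℝ) ≤ d := Nat.cast_nonneg _
      have hk' : (l : ℝ) * (1 / p) + l * (1 / q) = l := by rw [← mul_add, hinv, mul_one]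
      nlinarith
  calc (2 : ℝ) ^ (min k l) * (x k * y l)
      ≤ ((2 : ℝ) ^ ((k : ℝ) / p) * 2 ^ ((l : ℝ) / q) * ρ ^ ((l : ℤ) - k).natAbs) * (x k * y l) :=
        mul_le_mul_of_nonneg_right hexp (mul_nonneg (hx k) (hy l))
    _ = ((2 : ℝ) ^ ((k : ℝ) / p) * x k * (2 ^ ((l : ℝ) / q) * y l)) * ρ ^ ((l : ℤ) - k).natAbs := by
        ring
    _ ≤ _ := mul_le_mul_of_nonneg_right hY' (by positivity)


section aux4
variable {H : Type*} [NormedAddCommGroup H] [InnerProductSpace ℂ H] [CompleteSpace H]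

theorem hasSum_tele {C : H →L[ℂ] H} {G : ℕ → H →L[ℂ] H} (h0 : G 0 = 0)
    (he : Summable fun k => ‖C - G k‖) :
    (Summable fun k => ‖G (k + 1) - G k‖) ∧ HasSum (fun k => G (k + 1) - G k) C := by
  have h1 : Summable fun k => ‖G (k + 1) - G k‖ := by
    refine Summable.of_nonneg_of_le (fun _ => norm_nonneg _) (fun k => ?_)
      (he.add ((summable_nat_add_iff 1).2 he))
    have : G (k + 1) - G k = (C - G k) - (C - G (k + 1)) := by abel
    rw [this]
    exact norm_sub_le _ _
  refine ⟨h1, ?_⟩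
  have h2 := h1.of_norm.hasSum
  have h3 := h2.tendsto_sum_nat
  simp_rw [Finset.sum_range_sub, h0, sub_zero] at h3
  have h4 : Tendsto G atTop (nhds C) := by
    rw [tendsto_iff_norm_sub_tendsto_zero]
    simp_rw [norm_sub_rev _ C]
    exact he.tendsto_atTop_zero
  rwa [tendsto_nhds_unique h3 h4] at h2

theorem decomp_compact {C : H →L[ℂ] H} (hC : IsCompactOperator C) :
    ∃ (D : ℕ → H →L[ℂ] H) (r : ℕ → ℕ), (∀ k, Rk (r k) (D k)) ∧ (Summable fun k => ‖D k‖) ∧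
      HasSum D C := by
  have h := fun k : ℕ => exists_compact_approx C hC (ε := (1 / 2 : ℝ) ^ k) (by positivity)
  choose r F hF hCF using h
  let G : ℕ → H →L[ℂ] H := fun k => Nat.casesOn k 0 F
  let s : ℕ → ℕ := fun k => Nat.casesOn k 0 r
  have hG : ∀ k, Rk (s k) (G k) := by
    intro k
    cases k with
    | zero => exact Rk.zero
    | succ k => exact hF k
  have he : Summable fun k => ‖C - G k‖ := by
    rw [← summable_nat_add_iff 1]
    exact Summable.of_nonneg_of_le (fun _ => norm_nonneg _) hCF
      (summable_geometric_of_lt_one (by norm_num) (by norm_num))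
  obtain ⟨h1, h2⟩ := hasSum_tele (C := C) (G := G) rfl he
  exact ⟨_, fun k => s (k + 1) + s k, fun k => (hG (k + 1)).sub (hG k), h1, h2⟩

theorem decomp_schatten {C : H →L[ℂ] H} {p : ℝ} (hp : 1 ≤ p)
    (hC : Summable fun n => sv C n ^ p) :
    ∃ (D : ℕ → H →L[ℂ] H), (∀ k, Rk (4 * 2 ^ k) (D k)) ∧ (Summable fun k => ‖D k‖) ∧
      HasSum D C ∧ Summable fun k => (2 : ℝ) ^ k * ‖D k‖ ^ p := by
  have hp0 : 0 ≤ p := by linarith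
  have h := fun k : ℕ => exists_sv C (2 ^ k) (ε := (1 / 4 : ℝ) ^ k) (by positivity)
  choose F hF hCF using h
  let G : ℕ → H →L[ℂ] H := fun k => Nat.casesOn k 0 F
  have hG : ∀ k, Rk (2 ^ k) (G k) := by
    intro k
    cases k with
    | zero => exact Rk.zero.mono (Nat.zero_le _)
    | succ k => exact (hF k).mono (Nat.pow_le_pow_right (by norm_num) (Nat.le_succ k))
  have hcond : Summable fun k : ℕ => (2 : ℝ) ^ k * sv C (2 ^ k) ^ p :=
    (summable_condensed_iff_of_nonneg (f := fun n => sv C n ^ p)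
      (fun n => Real.rpow_nonneg (sv_nonneg C n) p)
      (fun m n _ hmn => Real.rpow_le_rpow (sv_nonneg C n) (sv_anti C hmn) hp0)).2 hC
  have he' : Summable fun k => (2 : ℝ) ^ k * ‖C - G k‖ ^ p := by
    rw [← summable_nat_add_iff 1]
    refine Summable.of_nonneg_of_le (fun k => by positivity) (fun k => ?_)
      ((hcond.add (summable_geometric_of_lt_one (r := (1 / 2 : ℝ)) (by norm_num)
        (by norm_num))).mul_left (2 * 2 ^ p))
    have hq : ((1 / 4 : ℝ) ^ k) ^ p ≤ (1 / 4 : ℝ) ^ k := by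
      conv_rhs => rw [← Real.rpow_one ((1 / 4 : ℝ) ^ k)]
      exact Real.rpow_le_rpow_of_exponent_ge (by positivity)
        (pow_le_one₀ (by norm_num) (by norm_num)) hp
    calc (2 : ℝ) ^ (k + 1) * ‖C - G (k + 1)‖ ^ p
        ≤ 2 ^ (k + 1) * (sv C (2 ^ k) + (1 / 4 : ℝ) ^ k) ^ p := by
          gcongr
          exact (hCF k).le
      _ ≤ 2 ^ (k + 1) * (2 ^ p * (sv C (2 ^ k) ^ p + ((1 / 4 : ℝ) ^ k) ^ p)) := by
          gcongr
          exact add_rpow_le_aux (sv_nonneg _ _) (by positivity) hp0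
      _ ≤ 2 ^ (k + 1) * (2 ^ p * (sv C (2 ^ k) ^ p + (1 / 4 : ℝ) ^ k)) := by
          gcongr
      _ = _ := by
          have : (1 / 4 : ℝ) ^ k * 2 ^ k = (1 / 2 : ℝ) ^ k := by
            rw [← mul_pow]; norm_num
          rw [← this]
          ring
  have he := summable_of_dyadic (fun k => norm_nonneg (C - G k)) hp he'
  obtain ⟨h1, h2⟩ := hasSum_tele (C := C) (G := G) rfl he
  refine ⟨_, fun k => ((hG (k + 1)).sub (hG k)).mono (s := 4 * 2 ^ k) ?_, h1, h2, ?_⟩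
  · rw [pow_succ]; omega
  · refine Summable.of_nonneg_of_le (fun k => by positivity) (fun k => ?_)
      ((he'.add ((summable_nat_add_iff 1).2 he')).mul_left (2 ^ p))
    have h3 : ‖G (k + 1) - G k‖ ≤ ‖C - G k‖ + ‖C - G (k + 1)‖ := by
      have : G (k + 1) - G k = (C - G k) - (C - G (k + 1)) := by abel
      rw [this]
      exact norm_sub_le _ _
    calc (2 : ℝ) ^ k * ‖G (k + 1) - G k‖ ^ p
        ≤ 2 ^ k * (‖C - G k‖ + ‖C - G (k + 1)‖) ^ p := by gcongr
      _ ≤ 2 ^ k * (2 ^ p * (‖C - G k‖ ^ p + ‖C - G (k + 1)‖ ^ p)) := by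
          gcongr
          exact add_rpow_le_aux (norm_nonneg _) (norm_nonneg _) hp0
      _ ≤ 2 ^ p * (2 ^ k * ‖C - G k‖ ^ p + 2 ^ (k + 1) * ‖C - G (k + 1)‖ ^ p) := by
          have h5 : 0 ≤ (2 : ℝ) ^ p * (2 ^ k * ‖C - G (k + 1)‖ ^ p) := by positivity
          rw [pow_succ]
          nlinarith

end aux4

/-- For conjugate `p, q`, `C ∈ B^p(H)`, `T ∈ B^q(H)` and `S n → S` strongly,
one has `tr(C (S n)† T (S n)) → tr(C S† T S)`. -/
theorem stmt_7 {H : Type*} [NormedAddCommGroup H] [InnerProductSpace ℂ H] [CompleteSpace H]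
    (b : HilbertBasis ℕ ℂ H)  -- `H` is infinite-dimensional and separable
    (p q : ℝ≥0∞) (hpq : 1 / p + 1 / q = 1)
    (C T : H →L[ℂ] H) (hC : MemSchatten p C) (hT : MemSchatten q T)
    (S : H →L[ℂ] H) (Sn : ℕ → H →L[ℂ] H)
    (hstrong : ∀ x : H, Tendsto (fun n => Sn n x) atTop (nhds (S x))) :
    Tendsto (fun n => traceAlong b (C * star (Sn n) * T * Sn n)) atTop
      (nhds (traceAlong b (C * star S * T * S))) := by
  obtain ⟨hCc, hCs⟩ := hC
  obtain ⟨hTc, hTs⟩ := hT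
  by_cases hp : p = ∞
  · have hq : q = 1 := by simpa [hp] using hpq
    subst hq
    obtain ⟨D, r, hr, hDn, hD⟩ := decomp_compact hCc
    obtain ⟨E, hs, hEn, hE, hEs⟩ := decomp_schatten (p := 1) le_rfl
      (by simpa using hTs (by simp))
    refine main_abstract b C T D E r (fun l => 4 * 2 ^ l) hr hs hDn hEn hD hE ?_ S Sn hstrong
    refine Summable.of_nonneg_of_le (fun z => by positivity) (fun z => ?_)
      ((hDn.mul_of_nonneg hEs (fun _ => norm_nonneg _) (fun _ => by positivity)).mul_left 4)
    calc _ ≤ ((4 * 2 ^ z.2 : ℕ) : ℝ) * (‖D z.1‖ * ‖E z.2‖) := by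
          gcongr
          exact min_le_right _ _
      _ = _ := by
          push_cast
          rw [Real.rpow_one]
          ring
  by_cases hq : q = ∞
  · have hp1 : p = 1 := by simpa [hq] using hpq
    subst hp1
    obtain ⟨E, s, hs, hEn, hE⟩ := decomp_compact hTc
    obtain ⟨D, hr, hDn, hD, hDs⟩ := decomp_schatten (p := 1) le_rfl
      (by simpa using hCs (by simp))
    refine main_abstract b C T D E (fun l => 4 * 2 ^ l) s hr hs hDn hEn hD hE ?_ S Sn hstrong
    refine Summable.of_nonneg_of_le (fun z => by positivity) (fun z => ?_)
      ((hDs.mul_of_nonneg hEn (fun _ => by positivity) (fun _ => norm_nonneg _)).mul_left 4)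
    calc _ ≤ ((4 * 2 ^ z.1 : ℕ) : ℝ) * (‖D z.1‖ * ‖E z.2‖) := by
          gcongr
          exact min_le_left _ _
      _ = _ := by
          push_cast
          rw [Real.rpow_one]
          ring
  have hp0 : p ≠ 0 := by rintro rfl; simp at hpq
  have hq0 : q ≠ 0 := by rintro rfl; simp at hpq
  have hP : 0 < p.toReal := ENNReal.toReal_pos hp0 hp
  have hQ : 0 < q.toReal := ENNReal.toReal_pos hq0 hq
  have hPQ : (p.toReal)⁻¹ + (q.toReal)⁻¹ = 1 := by
    have := congrArg ENNReal.toReal hpq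
    rw [ENNReal.toReal_add (by simp [hp0]) (by simp [hq0])] at this
    simpa using this
  have hQi : 0 < (q.toReal)⁻¹ := inv_pos.2 hQ
  have hP1 : 1 < p.toReal := (inv_lt_one₀ hP).1 (by linarith)
  have hconj : p.toReal.HolderConjugate q.toReal := Real.holderConjugate_iff.2 ⟨hP1, hPQ⟩
  obtain ⟨D, hr, hDn, hD, hDs⟩ := decomp_schatten hP1.le (hCs hp)
  obtain ⟨E, hs, hEn, hE, hEs⟩ := decomp_schatten hconj.symm.lt.le (hTs hq)
  refine main_abstract b C T D E (fun l => 4 * 2 ^ l) (fun l => 4 * 2 ^ l) hr hs hDn hEn hD hE ?_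
    S Sn hstrong
  refine ((summable_schur hconj (fun k => norm_nonneg (D k)) (fun k => norm_nonneg (E k))
    hDs hEs).mul_left 4).congr fun z => ?_
  have : min (4 * 2 ^ z.1) (4 * 2 ^ z.2) = 4 * 2 ^ (min z.1 z.2) := by
    rcases le_total z.1 z.2 with h | h
    · have h' : 2 ^ z.1 ≤ 2 ^ z.2 := Nat.pow_le_pow_right (by norm_num) h
      rw [min_eq_left h, min_eq_left (by omega)]
    · have h' : 2 ^ z.2 ≤ 2 ^ z.1 := Nat.pow_le_pow_right (by norm_num) h
      rw [min_eq_right h, min_eq_right (by omega)]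
  rw [this]
  push_cast
  ring
end

section
/- Let H be an infinite-dimensional separable complex Hilbert space, let p ∈ (1,∞] and q ∈ [1,∞) with 1/p + 1/q = 1, let C ∈ B^p(H), and let (e_n)_{n∈ℕ} be any orthonormal system in H. Then lim_{n→∞} n^{−1/q} ∑_{k=1}^n ⟨e_k, C e_k⟩ = 0. -/
open Filter
open scoped InnerProductSpace ENNReal

section helpers
variable {H : Type*} [NormedAddCommGroup H] [InnerProductSpace ℂ H]

lemma aux_expand (V : Submodule ℂ H) [FiniteDimensional ℂ V] (w : H) (hw : w ∈ V) :
    w = ∑ i, ⟪((stdOrthonormalBasis ℂ V i : V) : H), w⟫_ℂ • ((stdOrthonormalBasis ℂ V i : V) : H) := by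
  have h := (stdOrthonormalBasis ℂ V).sum_repr' ⟨w, hw⟩
  have h2 := congrArg (Subtype.val) h
  simp only [Submodule.coe_sum, Submodule.coe_smul, Submodule.coe_inner] at h2
  exact h2.symm

lemma aux_trace [CompleteSpace H] (V : Submodule ℂ H) [FiniteDimensional ℂ V] (A : H →L[ℂ] H)
    (hA : ∀ x, A x ∈ V) (e : ℕ → H) (he : Orthonormal ℂ e) (n : ℕ) :
    ‖∑ k ∈ Finset.range n, ⟪e k, A (e k)⟫_ℂ‖ ≤ Module.finrank ℂ V * ‖A‖ := by
  set v : Fin (Module.finrank ℂ V) → H := fun i => ((stdOrthonormalBasis ℂ V i : V) : H) with hv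
  have hv1 : ∀ i, ‖v i‖ = 1 := fun i => (stdOrthonormalBasis ℂ V).orthonormal.1 i
  have h1 : ∀ k, ⟪e k, A (e k)⟫_ℂ
      = ∑ i, ⟪v i, A (e k)⟫_ℂ * ⟪e k, v i⟫_ℂ := by
    intro k
    conv_lhs => rw [aux_expand V (A (e k)) (hA _)]
    simp only [inner_sum, inner_smul_right, hv]
  simp_rw [h1]
  rw [Finset.sum_comm]
  refine (norm_sum_le _ _).trans ?_
  have h2 : ∀ i, ‖∑ k ∈ Finset.range n, ⟪v i, A (e k)⟫_ℂ * ⟪e k, v i⟫_ℂ‖ ≤ ‖A‖ := by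
    intro i
    refine (norm_sum_le _ _).trans ?_
    have h3 : ∑ k ∈ Finset.range n, ‖⟪e k, v i⟫_ℂ‖ ^ 2 ≤ 1 := by
      have := he.sum_inner_products_le (v i) (s := Finset.range n)
      rwa [hv1, one_pow] at this
    have h4 : ∑ k ∈ Finset.range n, ‖⟪v i, A (e k)⟫_ℂ‖ ^ 2 ≤ ‖A‖ ^ 2 := by
      have := he.sum_inner_products_le (ContinuousLinearMap.adjoint A (v i)) (s := Finset.range n)
      have h5 : ‖ContinuousLinearMap.adjoint A (v i)‖ ≤ ‖A‖ := by
        have := (ContinuousLinearMap.adjoint A).le_opNorm (v i)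
        rwa [hv1, mul_one, LinearIsometryEquiv.norm_map] at this
      calc _ = ∑ k ∈ Finset.range n, ‖⟪e k, ContinuousLinearMap.adjoint A (v i)⟫_ℂ‖ ^ 2 := by
              refine Finset.sum_congr rfl fun k _ => ?_
              rw [ContinuousLinearMap.adjoint_inner_right, ← norm_inner_symm]
        _ ≤ _ := this
        _ ≤ _ := by gcongr
    have h6 := Finset.sum_mul_sq_le_sq_mul_sq (Finset.range n) (fun k => ‖⟪v i, A (e k)⟫_ℂ‖)
      (fun k => ‖⟪e k, v i⟫_ℂ‖)
    simp only [norm_mul]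
    refine le_of_sq_le_sq ?_ (norm_nonneg _)
    calc _ ≤ _ := h6
      _ ≤ ‖A‖ ^ 2 * 1 := by gcongr
      _ = _ := mul_one _
  refine (Finset.sum_le_sum fun i _ => h2 i).trans ?_
  simp

lemma aux_sv_nonneg (T : H →L[ℂ] H) (n : ℕ) : 0 ≤ sv T n :=
  Real.iInf_nonneg fun _ => Real.iInf_nonneg fun _ => norm_nonneg _

lemma aux_sv_le (T : H →L[ℂ] H) (n : ℕ) (u v : Fin n → H) :
    sv T n ≤ ‖T - ∑ i, rankOne (u i) (v i)‖ := by
  unfold sv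
  refine (ciInf_le ⟨0, ?_⟩ u).trans (ciInf_le ⟨0, ?_⟩ v)
  · rintro _ ⟨u, rfl⟩
    exact Real.iInf_nonneg fun _ => norm_nonneg _
  · rintro _ ⟨u, rfl⟩
    exact norm_nonneg _

lemma aux_sv_exists (T : H →L[ℂ] H) (n : ℕ) (ε : ℝ) (hε : 0 < ε) :
    ∃ u v : Fin n → H, ‖T - ∑ i, rankOne (u i) (v i)‖ < sv T n + ε := by
  have h : sv T n < sv T n + ε := by linarith
  conv_lhs at h => unfold sv
  obtain ⟨u, hu⟩ := exists_lt_of_ciInf_lt h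
  obtain ⟨v, hv⟩ := exists_lt_of_ciInf_lt hu
  exact ⟨u, v, hv⟩

lemma aux_sv_anti (T : H →L[ℂ] H) : Antitone (sv T) := by
  refine antitone_nat_of_succ_le fun n => ?_
  refine le_of_forall_pos_le_add fun ε hε => ?_
  obtain ⟨u, v, h⟩ := aux_sv_exists T n ε hε
  refine (aux_sv_le T (n+1) (Fin.snoc u 0) (Fin.snoc v 0)).trans ?_
  rw [Fin.sum_univ_castSucc]
  have : rankOne (0 : H) (0 : H) = 0 := by ext; simp [rankOne]
  simp only [Fin.snoc_castSucc, Fin.snoc_last, this, add_zero]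
  exact h.le

lemma aux_sv_tendsto [CompleteSpace H] (T : H →L[ℂ] H) (hT : IsCompactOperator T) :
    Tendsto (sv T) atTop (nhds 0) := by
  rw [Metric.tendsto_atTop]
  intro ε hε
  have hc : IsCompact (closure (T '' Metric.closedBall 0 1)) :=
    IsCompactOperator.isCompact_closure_image_closedBall (f := (T : H →ₗ[ℂ] H)) hT 1
  obtain ⟨t, htf, ht⟩ := Metric.totallyBounded_iff.1 hc.totallyBounded (ε/2) (by positivity)
  set V := Submodule.span ℂ t with hV
  have : FiniteDimensional ℂ V := FiniteDimensional.span_of_finite ℂ htf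
  set v : Fin (Module.finrank ℂ V) → H := fun i => ((stdOrthonormalBasis ℂ V i : V) : H) with hv
  have key : sv T (Module.finrank ℂ V) ≤ ε/2 := by
    refine (aux_sv_le T _ (fun i => ContinuousLinearMap.adjoint T (v i)) v).trans ?_
    have hP : ∀ x, (∑ i, rankOne (ContinuousLinearMap.adjoint T (v i)) (v i)) x
        = V.starProjection (T x) := by
      intro x
      rw [aux_expand V (V.starProjection (T x)) (Submodule.starProjection_apply_mem _ _)]
      simp only [rankOne, ContinuousLinearMap.sum_apply, ContinuousLinearMap.smulRight_apply,
        innerSL_apply_apply, ContinuousLinearMap.adjoint_inner_left]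
      refine Finset.sum_congr rfl fun i _ => ?_
      congr 1
      rw [← Submodule.inner_starProjection_left_eq_right,
        Submodule.starProjection_eq_self_iff.2 (Subtype.mem _)]
    refine ContinuousLinearMap.opNorm_le_of_unit_norm (by positivity) fun x hx => ?_
    rw [ContinuousLinearMap.sub_apply, hP]
    have hx' : T x ∈ closure (T '' Metric.closedBall 0 1) :=
      subset_closure ⟨x, by simp [hx], rfl⟩
    obtain ⟨y, hy, hyx⟩ := Set.mem_iUnion₂.1 (ht hx')
    have hyV : y ∈ V := Submodule.subset_span hy
    rw [Submodule.starProjection_minimal]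
    have := ciInf_le (f := fun w : V => ‖T x - w‖) ⟨0, by rintro _ ⟨u, rfl⟩; exact norm_nonneg _⟩
      ⟨y, hyV⟩
    rw [Metric.mem_ball, dist_eq_norm] at hyx
    exact this.trans hyx.le
  refine ⟨Module.finrank ℂ V, fun n hn => ?_⟩
  · rw [Real.dist_0_eq_abs, abs_of_nonneg (aux_sv_nonneg _ _)]
    have := aux_sv_anti T hn
    linarith [this.trans key]

end helpers

lemma aux_rec (x h : ℕ → ℝ) (r : ℝ) (hr0 : 0 ≤ r) (hr : r < 1) (hx : ∀ n, 0 ≤ x n)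
    (hrec : ∀ n, x (n+1) ≤ r * x n + h n) (hh : Tendsto h atTop (nhds 0)) :
    Tendsto x atTop (nhds 0) := by
  rw [Metric.tendsto_atTop]
  intro ε hε
  have h1r : 0 < 1 - r := by linarith
  obtain ⟨N, hN⟩ := Metric.tendsto_atTop.1 hh (ε/2 * (1-r)) (by positivity)
  have h1 : ∀ n, x (N + n) ≤ r ^ n * x N + ε/2 := by
    intro n
    induction n with
    | zero => simp; linarith
    | succ n ih =>
      have h2 := hrec (N+n)
      have h3 := hN (N+n) (by omega)
      rw [Real.dist_0_eq_abs] at h3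
      have h4 := (abs_lt.1 h3).2
      have h5 := mul_le_mul_of_nonneg_left ih hr0
      rw [← add_assoc, pow_succ]
      nlinarith
  have h2 : Tendsto (fun n => r ^ n * x N) atTop (nhds 0) := by
    simpa using (tendsto_pow_atTop_nhds_zero_of_lt_one hr0 hr).mul_const (x N)
  obtain ⟨M, hM⟩ := Metric.tendsto_atTop.1 h2 (ε/2) (by positivity)
  refine ⟨N + M, fun n hn => ?_⟩
  obtain ⟨m, rfl⟩ : ∃ m, n = N + m := ⟨n - N, by omega⟩
  have h3 := hM m (by omega)
  rw [Real.dist_0_eq_abs] at h3 ⊢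
  rw [abs_of_nonneg (hx _)]
  linarith [h1 m, (abs_lt.1 h3).2]

lemma aux_main {H : Type*} [NormedAddCommGroup H] [InnerProductSpace ℂ H] [CompleteSpace H]
    (θ : ℝ) (h0 : 0 < θ) (h1 : θ ≤ 1) (C : H →L[ℂ] H)
    (hs : Tendsto (fun j : ℕ => ((2:ℝ) ^ (1 - θ)) ^ j * sv C (2 ^ j)) atTop (nhds 0))
    (e : ℕ → H) (he : Orthonormal ℂ e) :
    Tendsto (fun n : ℕ =>
        (((n : ℝ) ^ θ)⁻¹ : ℝ) • ∑ k ∈ Finset.range n, ⟪e k, C (e k)⟫_ℂ)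
      atTop (nhds 0) := by
  set σ : ℝ := (2:ℝ) ^ (1 - θ) with hσ
  set ρ : ℝ := (2:ℝ) ^ θ with hρ
  have hρσ : ρ * σ = 2 := by
    rw [hρ, hσ, ← Real.rpow_add (by norm_num)]; simp
  have hσ1 : 1 ≤ σ := Real.one_le_rpow (by norm_num) (by linarith)
  have hρ1 : 1 < ρ := Real.one_lt_rpow (by norm_num) h0
  have hρ0 : 0 < ρ := by linarith
  have hσ0 : 0 < σ := by linarith
  have hpow : ∀ j : ℕ, (2:ℝ) ^ j = ρ ^ j * σ ^ j := fun j => by rw [← mul_pow, hρσ]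
  have hchoose : ∀ j : ℕ, ∃ u v : Fin (2^j) → H,
      ‖C - ∑ i, rankOne (u i) (v i)‖ < sv C (2^j) + (1/2:ℝ)^j :=
    fun j => aux_sv_exists C _ _ (by positivity)
  choose u v huv using hchoose
  set F : ℕ → H →L[ℂ] H := fun j => ∑ i, rankOne (u j i) (v j i) with hF
  set d : ℕ → ℝ := fun j => ‖C - F j‖ with hd
  set g : ℕ → ℝ := fun j => σ ^ j * d j with hg
  have hd0 : ∀ j, 0 ≤ d j := fun j => norm_nonneg _
  have hg0 : ∀ j, 0 ≤ g j := fun j => mul_nonneg (by positivity) (hd0 j)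
  have hgt : Tendsto g atTop (nhds 0) := by
    have h2 : Tendsto (fun j : ℕ => σ ^ j * sv C (2 ^ j) + (σ * (1/2)) ^ j) atTop (nhds 0) := by
      have : Tendsto (fun j : ℕ => (σ * (1/2)) ^ j) atTop (nhds 0) :=
        tendsto_pow_atTop_nhds_zero_of_lt_one (by positivity) (by nlinarith)
      simpa using hs.add this
    refine squeeze_zero hg0 (fun j => ?_) h2
    rw [mul_pow, ← mul_add]
    exact mul_le_mul_of_nonneg_left (huv j).le (by positivity)
  set V : ℕ → Submodule ℂ H := fun j => Submodule.span ℂ (Set.range (v j)) with hV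
  have hVfin : ∀ j, FiniteDimensional ℂ (V j) :=
    fun j => FiniteDimensional.span_of_finite ℂ (Set.finite_range _)
  have hVr : ∀ j, Module.finrank ℂ (V j) ≤ 2 ^ j := fun j => by
    have h := finrank_range_le_card (R := ℂ) (v j)
    rw [Fintype.card_fin] at h
    exact h
  have hFV : ∀ j x, F j x ∈ V j := by
    intro j x
    simp only [hF, rankOne, sum_apply, ContinuousLinearMap.smulRight_apply]
    exact Submodule.sum_mem _ fun i _ => Submodule.smul_mem _ _ (Submodule.subset_span ⟨i, rfl⟩)
  set G : ℕ → ℝ := fun j => 3 * (g j + g (j+1)) with hG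
  have hG0 : ∀ j, 0 ≤ G j := fun j => by have := hg0 j; have := hg0 (j+1); simp only [hG]; positivity
  set a : ℕ → ℝ := fun j => ‖F 0‖ + ∑ i ∈ Finset.range j, ρ ^ i * G i with ha
  have ha0 : ∀ j, 0 ≤ a j := fun j => add_nonneg (norm_nonneg _)
    (Finset.sum_nonneg fun i _ => mul_nonneg (by positivity) (hG0 i))
  have hbound : ∀ n j, ‖∑ k ∈ Finset.range n, ⟪e k, F j (e k)⟫_ℂ‖ ≤ a j := by
    intro n j
    induction j with
    | zero =>
      refine (aux_trace (V 0) (F 0) (hFV 0) e he n).trans ?_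
      have : (Module.finrank ℂ (V 0) : ℝ) ≤ 1 := by exact_mod_cast hVr 0
      simp only [ha, Finset.range_zero, Finset.sum_empty, add_zero]
      exact mul_le_of_le_one_left (norm_nonneg _) this
    | succ j ih =>
      have hmem : ∀ x, (F (j+1) - F j) x ∈ V (j+1) ⊔ V j := fun x =>
        Submodule.sub_mem _ (Submodule.mem_sup_left (hFV _ x)) (Submodule.mem_sup_right (hFV _ x))
      have h2 := aux_trace (V (j+1) ⊔ V j) (F (j+1) - F j) hmem e he n
      have h3 : (Module.finrank ℂ ↥(V (j+1) ⊔ V j) : ℝ) ≤ 3 * 2 ^ j := by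
        have h4 := Submodule.finrank_add_le_finrank_add_finrank (V (j+1)) (V j)
        have h5 := hVr (j+1)
        have h6 := hVr j
        have : Module.finrank ℂ ↥(V (j+1) ⊔ V j) ≤ 3 * 2 ^ j := by
          rw [pow_succ] at h5; omega
        exact_mod_cast this
      have h4 : ‖F (j+1) - F j‖ ≤ d j + d (j+1) := by
        have : F (j+1) - F j = (C - F j) - (C - F (j+1)) := by abel
        rw [this]; exact norm_sub_le _ _
      have h5 : 3 * 2 ^ j * (d j + d (j+1)) ≤ ρ ^ j * G j := by
        have h6 : σ ^ j * d (j+1) ≤ g (j+1) := by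
          simp only [hg]
          exact mul_le_mul_of_nonneg_right (pow_le_pow_right₀ hσ1 (by omega)) (hd0 _)
        calc 3 * 2 ^ j * (d j + d (j+1)) = ρ ^ j * (3 * (σ ^ j * d j + σ ^ j * d (j+1))) := by
              rw [hpow]; ring
          _ ≤ ρ ^ j * (3 * (g j + g (j+1))) := by gcongr
      have h6 : ∑ k ∈ Finset.range n, ⟪e k, F (j+1) (e k)⟫_ℂ
          = ∑ k ∈ Finset.range n, ⟪e k, F j (e k)⟫_ℂ
            + ∑ k ∈ Finset.range n, ⟪e k, (F (j+1) - F j) (e k)⟫_ℂ := by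
        rw [← Finset.sum_add_distrib]
        refine Finset.sum_congr rfl fun k _ => ?_
        rw [← inner_add_right]; simp
      have h7 : a (j+1) = a j + ρ ^ j * G j := by
        simp only [ha, Finset.sum_range_succ]; ring
      rw [h6, h7]
      refine (norm_add_le _ _).trans (add_le_add ih (h2.trans (le_trans ?_ h5)))
      gcongr
  set x : ℕ → ℝ := fun j => a j / ρ ^ j with hx
  have hxt : Tendsto x atTop (nhds 0) := by
    refine aux_rec x (fun j => ρ⁻¹ * G j) ρ⁻¹ (by positivity) (inv_lt_one_of_one_lt₀ hρ1)
      (fun j => div_nonneg (ha0 j) (by positivity)) (fun j => ?_) ?_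
    · have h7 : a (j+1) = a j + ρ ^ j * G j := by
        simp only [ha, Finset.sum_range_succ]; ring
      refine le_of_eq ?_
      simp only [hx, h7, pow_succ]
      field_simp
    · have : Tendsto G atTop (nhds 0) := by
        simpa using (hgt.add (hgt.comp (tendsto_add_atTop_nat 1))).const_mul 3
      simpa using this.const_mul ρ⁻¹
  have hlog : Tendsto (fun n : ℕ => Nat.log 2 n) atTop atTop := by
    refine tendsto_atTop.2 fun b => ?_
    filter_upwards [eventually_ge_atTop (2 ^ b)] with n hn
    exact Nat.le_log_of_pow_le (by norm_num) hn
  have hfin : Tendsto (fun n : ℕ => 2 * g (Nat.log 2 n) + x (Nat.log 2 n)) atTop (nhds 0) := by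
    simpa using ((hgt.comp hlog).const_mul 2).add (hxt.comp hlog)
  refine squeeze_zero_norm' ?_ hfin
  filter_upwards [eventually_ge_atTop 1] with n hn
  set J := Nat.log 2 n with hJ
  have hJ1 : (2:ℝ) ^ J ≤ n := by exact_mod_cast Nat.pow_log_le_self 2 (by omega)
  have hJ2 : (n:ℝ) ≤ 2 * 2 ^ J := by
    have : n < 2 ^ (J+1) := Nat.lt_pow_succ_log_self (by norm_num) n
    rw [pow_succ] at this
    have h : n ≤ 2 * 2 ^ J := by omega
    exact_mod_cast h
  have hJ3 : ρ ^ J ≤ (n:ℝ) ^ θ := by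
    have : ρ ^ J = ((2:ℝ) ^ J) ^ θ := by
      rw [hρ, ← Real.rpow_natCast, ← Real.rpow_natCast, ← Real.rpow_mul (by norm_num),
        ← Real.rpow_mul (by norm_num), mul_comm]
    rw [this]
    exact Real.rpow_le_rpow (by positivity) hJ1 h0.le
  have hn0 : 0 < (n:ℝ) ^ θ := lt_of_lt_of_le (by positivity) hJ3
  have hS : ‖∑ k ∈ Finset.range n, ⟪e k, C (e k)⟫_ℂ‖ ≤ n * d J + a J := by
    have h6 : ∑ k ∈ Finset.range n, ⟪e k, C (e k)⟫_ℂ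
          = ∑ k ∈ Finset.range n, ⟪e k, (C - F J) (e k)⟫_ℂ
            + ∑ k ∈ Finset.range n, ⟪e k, F J (e k)⟫_ℂ := by
      rw [← Finset.sum_add_distrib]
      refine Finset.sum_congr rfl fun k _ => ?_
      rw [← inner_add_right]; simp
    rw [h6]
    refine (norm_add_le _ _).trans (add_le_add ?_ (hbound n J))
    refine (norm_sum_le _ _).trans ?_
    have : ∀ k ∈ Finset.range n, ‖⟪e k, (C - F J) (e k)⟫_ℂ‖ ≤ d J := by
      intro k _
      refine (norm_inner_le_norm _ _).trans ?_
      have := (C - F J).le_opNorm (e k)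
      rw [he.1 k, mul_one] at this
      rw [he.1 k, one_mul]; exact this
    refine (Finset.sum_le_sum this).trans ?_
    simp
  rw [norm_smul, norm_inv, Real.norm_of_nonneg hn0.le, inv_mul_le_iff₀ hn0]
  refine hS.trans ?_
  have e1 : n * d J ≤ ρ ^ J * (2 * g J) := by
    calc n * d J ≤ 2 * 2 ^ J * d J := mul_le_mul_of_nonneg_right hJ2 (hd0 J)
      _ = _ := by rw [hpow]; simp only [hg]; ring
  have e2 : a J = ρ ^ J * x J := by simp only [hx]; field_simp
  have e3 : 0 ≤ x J := div_nonneg (ha0 J) (by positivity)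
  have e4 := hg0 J
  calc _ ≤ ρ ^ J * (2 * g J) + ρ ^ J * x J := by rw [← e2]; linarith
    _ = ρ ^ J * (2 * g J + x J) := by ring
    _ ≤ _ := by gcongr

/-- For conjugate `p ∈ (1,∞]`, `q ∈ [1,∞)`, `C ∈ B^p(H)` and any
orthonormal system `(e n)` in `H`, one has `n^{-1/q} ∑_{k=1}^n ⟪e k, C (e k)⟫ → 0`. -/
theorem stmt_10 {H : Type*} [NormedAddCommGroup H] [InnerProductSpace ℂ H] [CompleteSpace H]
    (b : HilbertBasis ℕ ℂ H)  -- `H` is infinite-dimensional and separable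
    (p q : ℝ≥0∞) (hp : 1 < p) (hq : q ≠ ∞) (hpq : 1 / p + 1 / q = 1)
    (C : H →L[ℂ] H) (hC : MemSchatten p C)
    (e : ℕ → H) (he : Orthonormal ℂ e) :
    Tendsto (fun n : ℕ =>
        (((n : ℝ) ^ (1 / q.toReal))⁻¹ : ℝ) • ∑ k ∈ Finset.range n, ⟪e k, C (e k)⟫_ℂ)
      atTop (nhds 0) := by

  obtain ⟨hCc, hCs⟩ := hC
  have hq0 : q ≠ 0 := by
    rintro rfl
    simp at hpq
  have hp0 : p ≠ 0 := by rintro rfl; simp at hp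
  have hqr : 0 < q.toReal := ENNReal.toReal_pos hq0 hq
  have hθ : 1 / p.toReal + 1 / q.toReal = 1 := by
    have := congrArg ENNReal.toReal hpq
    rw [ENNReal.toReal_add (by simp [hp0]) (by simp [hq0])] at this
    simpa using this
  have hp1 : 0 ≤ 1 / p.toReal := by positivity
  refine aux_main (1 / q.toReal) (by positivity) (by linarith) C ?_ e he
  have h1 : 1 - 1 / q.toReal = 1 / p.toReal := by linarith
  rw [h1]
  by_cases hpt : p = ∞
  · subst hpt
    simpa [Function.comp_def] using (aux_sv_tendsto C hCc).comp (tendsto_pow_atTop_atTop_of_one_lt (r := 2) (by norm_num))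
  · have hpr : 0 < p.toReal := ENNReal.toReal_pos hp0 hpt
    have hsum := (summable_condensed_iff_of_nonneg
      (fun n => Real.rpow_nonneg (aux_sv_nonneg C n) p.toReal)
      (fun m n _ hmn => Real.rpow_le_rpow (aux_sv_nonneg C n) (aux_sv_anti C hmn) hpr.le)).2
      (hCs hpt)
    have ht := hsum.tendsto_atTop_zero.rpow_const (p := 1 / p.toReal) (Or.inr hp1)
    rw [Real.zero_rpow (by positivity)] at ht
    refine ht.congr fun j => ?_
    rw [Real.mul_rpow (by positivity) (Real.rpow_nonneg (aux_sv_nonneg C _) _),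
      ← Real.rpow_mul (aux_sv_nonneg C _), mul_one_div_cancel hpr.ne', Real.rpow_one]
    congr 1
    rw [← Real.rpow_natCast, ← Real.rpow_natCast, ← Real.rpow_mul (by norm_num),
        ← Real.rpow_mul (by norm_num), mul_comm]
end
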